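/- Let R, R₁, R₂, R₁₂ be complete normed commutative rings (commutative Banach rings) together with continuous ring homomorphisms R → R₁, R → R₂, R₁ → R₁₂, R₂ → R₁₂ forming a commuting square, such that the induced sequence 0 → R → R₁ ⊕ R₂ → R₁₂ → 0 (where the first map is r ↦ (r, r) and the second is (a, b) ↦ a − b, with a and b mapped into R₁₂) is a strict exact sequence of Banach modules (i.e., it is exact, the first map is a closed topological embedding, and the second map is a continuous open surjection), and such that the image of R₂ in R₁₂ is dense. Suppose given a finite projective R₁-module M₁, a finite projective R₂-module M₂, and an isomorphism of R₁₂-modules ψ : M₁ ⊗_{R₁} R₁₂ ≅ M₂ ⊗_{R₂} R₁₂ (a descent datum of finite projective modules over the glueing square). Let M be the R-module equalizer of the two induced maps M₁ ⊕ M₂ → M₂ ⊗_{R₂} R₁₂, i.e., M = { (m₁, m₂) : ψ(m₁ ⊗ 1) = m₂ ⊗ 1 }. Then M is a finite projective R-module, and the natural base-change maps M ⊗_R R₁ → M₁ and M ⊗_R R₂ → M₂ are isomorphisms of R₁-modules and R₂-modules respectively. -/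

import Mathlib

open TensorProduct

section GlueingSquare

variable (R : Type*) {R₁ R₂ R₁₂ M₁ M₂ : Type*}
  [CommRing R] [CommRing R₁] [CommRing R₂] [CommRing R₁₂]
  [Algebra R R₁] [Algebra R R₂] [Algebra R R₁₂]
  [Algebra R₁ R₁₂] [Algebra R₂ R₁₂]
  [IsScalarTower R R₁ R₁₂] [IsScalarTower R R₂ R₁₂]
  [AddCommGroup M₁] [Module R₁ M₁] [Module R M₁] [IsScalarTower R R₁ M₁]
  [AddCommGroup M₂] [Module R₂ M₂] [Module R M₂] [IsScalarTower R R₂ M₂]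

/-- Given a descent datum `ψ : R₁₂ ⊗[R₁] M₁ ≃ R₁₂ ⊗[R₂] M₂`, the `R`-linear map
`M₁ × M₂ → R₁₂ ⊗[R₂] M₂`, `(m₁, m₂) ↦ ψ(1 ⊗ m₁) - 1 ⊗ m₂`, whose kernel is the
equalizer module of the descent datum. -/
noncomputable def glueMap (ψ : (R₁₂ ⊗[R₁] M₁) ≃ₗ[R₁₂] (R₁₂ ⊗[R₂] M₂)) :
    (M₁ × M₂) →ₗ[R] R₁₂ ⊗[R₂] M₂ :=
  ((ψ.toLinearMap.restrictScalars R).comp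
      (((TensorProduct.mk R₁ R₁₂ M₁ 1).restrictScalars R).comp (LinearMap.fst R M₁ M₂)))
    - (((TensorProduct.mk R₂ R₁₂ M₂ 1).restrictScalars R).comp (LinearMap.snd R M₁ M₂))

/-- The equalizer `R`-module `M = { (m₁, m₂) : ψ(m₁ ⊗ 1) = m₂ ⊗ 1 }` of a descent datum
over the glueing square `R → R₁, R → R₂, R₁ → R₁₂, R₂ → R₁₂`. -/
noncomputable def gluedModule (ψ : (R₁₂ ⊗[R₁] M₁) ≃ₗ[R₁₂] (R₁₂ ⊗[R₂] M₂)) :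
    Submodule R (M₁ × M₂) :=
  LinearMap.ker (glueMap R ψ)

end GlueingSquare

section NearlyOpen

/-- An additive map between normed groups, with complete source, that is open at the origin up to
arbitrarily small errors with modulus `δ` is open at the origin, with modulus `ε ↦ δ (ε / 4)`. -/
theorem exists_norm_lt_map_eq_of_nearly_open {G H : Type*} [NormedAddCommGroup G]
    [CompleteSpace G] [NormedAddCommGroup H] (f : G →+ H) (hf : Continuous f)
    {δ : ℝ → ℝ} (hδ : ∀ ε > 0, 0 < δ ε)
    (h : ∀ ε > 0, ∀ y : H, ‖y‖ < δ ε → ∀ θ > 0, ∃ x : G, ‖x‖ < ε ∧ ‖y - f x‖ < θ)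
    {ε : ℝ} (hε : 0 < ε) {y : H} (hy : ‖y‖ < δ (ε / 4)) : ∃ x : G, ‖x‖ < ε ∧ f x = y := by
  have hpos : ∀ k : ℕ, 0 < ε / 4 * (1 / 2) ^ k := fun k => by positivity
  have hstep : ∀ (k : ℕ) (y : H), ∃ x : G, ‖y‖ < δ (ε / 4 * (1 / 2) ^ k) →
      ‖x‖ < ε / 4 * (1 / 2) ^ k ∧ ‖y - f x‖ < min (δ (ε / 4 * (1 / 2) ^ (k + 1))) ((1 / 2) ^ k) := by
    intro k y
    by_cases hy : ‖y‖ < δ (ε / 4 * (1 / 2) ^ k)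
    · obtain ⟨x, hx⟩ := h _ (hpos k) y hy (min (δ (ε / 4 * (1 / 2) ^ (k + 1))) ((1 / 2) ^ k))
        (lt_min (hδ _ (hpos _)) (by positivity))
      exact ⟨x, fun _ => hx⟩
    · exact ⟨0, fun hy' => absurd hy' hy⟩
  choose g hg using hstep
  let r : ℕ → H := fun n => Nat.rec y (fun k z => z - f (g k z)) n
  have hr_succ : ∀ n, r (n + 1) = r n - f (g n (r n)) := fun n => rfl
  have hr : ∀ n, ‖r n‖ < δ (ε / 4 * (1 / 2) ^ n) := by
    intro n
    induction n with
    | zero => simpa [r] using hy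
    | succ n ih => exact (hg n (r n) ih).2.trans_le (min_le_left _ _)
  have hsum : ∀ n, f (∑ k ∈ Finset.range n, g k (r k)) = y - r n := by
    intro n
    induction n with
    | zero => simp [r]
    | succ n ih => rw [Finset.sum_range_succ, map_add, ih, hr_succ]; abel
  have hr_lim : Filter.Tendsto r Filter.atTop (nhds 0) := by
    rw [← Filter.tendsto_add_atTop_iff_nat 1]
    refine squeeze_zero_norm (fun n => ((hg n (r n) (hr n)).2.trans_le (min_le_right _ _)).le) ?_
    exact tendsto_pow_atTop_nhds_zero_of_lt_one (by norm_num) (by norm_num)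
  have hgeom : HasSum (fun k : ℕ => ε / 4 * (1 / 2 : ℝ) ^ k) (ε / 4 * 2) :=
    hasSum_geometric_two.mul_left _
  have hbound : ∀ k, ‖g k (r k)‖ ≤ ε / 4 * (1 / 2) ^ k := fun k => (hg k (r k) (hr k)).1.le
  have hsummable : Summable fun k => g k (r k) := hgeom.summable.of_norm_bounded hbound
  refine ⟨∑' k, g k (r k), (tsum_of_norm_bounded hgeom hbound).trans_lt (by linarith), ?_⟩
  refine tendsto_nhds_unique ((hf.tendsto _).comp hsummable.hasSum.tendsto_sum_nat) ?_
  simp only [Function.comp_def, hsum]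
  simpa using hr_lim.const_sub y

end NearlyOpen

section Factorization

theorem norm_le_two_mul_norm_one_sub_mul {A : Type*} [NormedRing A] {r : A} (hr : ‖r‖ ≤ 1 / 2)
    (x : A) : ‖x‖ ≤ 2 * ‖(1 - r) * x‖ := by
  have h : ‖x‖ ≤ ‖(1 - r) * x‖ + ‖r‖ * ‖x‖ :=
    calc ‖x‖ = ‖(1 - r) * x + r * x‖ := by congr 1; noncomm_ring
      _ ≤ ‖(1 - r) * x‖ + ‖r‖ * ‖x‖ := (norm_add_le _ _).trans (by gcongr; exact norm_mul_le _ _)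
  nlinarith [norm_nonneg x]

theorem norm_le_two_mul_norm_mul_one_sub {A : Type*} [NormedRing A] {r : A} (hr : ‖r‖ ≤ 1 / 2)
    (x : A) : ‖x‖ ≤ 2 * ‖x * (1 - r)‖ := by
  have h : ‖x‖ ≤ ‖x * (1 - r)‖ + ‖x‖ * ‖r‖ :=
    calc ‖x‖ = ‖x * (1 - r) + x * r‖ := by congr 1; noncomm_ring
      _ ≤ ‖x * (1 - r)‖ + ‖x‖ * ‖r‖ := (norm_add_le _ _).trans (by gcongr; exact norm_mul_le _ _)
  nlinarith [norm_nonneg x]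

theorem exists_one_sub_mul_eq {A : Type*} [NormedRing A] [CompleteSpace A] {r : A}
    (hr : ‖r‖ ≤ 1 / 2) (x : A) : ∃ y, (1 - r) * y = x ∧ ‖y‖ ≤ 2 * ‖x‖ := by
  have hu : (1 - r) * (↑(Units.oneSub r (by linarith))⁻¹ * x) = x :=
    (Units.oneSub r (by linarith)).mul_inv_cancel_left x
  refine ⟨_, hu, ?_⟩
  simpa only [hu] using norm_le_two_mul_norm_one_sub_mul hr
    (↑(Units.oneSub r (by linarith))⁻¹ * x)

theorem exists_mul_one_sub_eq {A : Type*} [NormedRing A] [CompleteSpace A] {r : A}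
    (hr : ‖r‖ ≤ 1 / 2) (x : A) : ∃ y, y * (1 - r) = x ∧ ‖y‖ ≤ 2 * ‖x‖ := by
  have hu : x * ↑(Units.oneSub r (by linarith))⁻¹ * (1 - r) = x :=
    (Units.oneSub r (by linarith)).inv_mul_cancel_right x
  refine ⟨_, hu, ?_⟩
  simpa only [hu] using norm_le_two_mul_norm_mul_one_sub hr
    (x * ↑(Units.oneSub r (by linarith))⁻¹)

variable {A₁ A₂ A₁₂ : Type*} [NormedRing A₁] [NormedRing A₂] [NormedRing A₁₂]
  [CompleteSpace A₁] [CompleteSpace A₂] [CompleteSpace A₁₂]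
  {φ₁ : A₁ →+* A₁₂} {φ₂ : A₂ →+* A₁₂}

theorem norm_mul_one_sub_lt {A : Type*} [NormedRing A] {s t : A} {ε : ℝ} (hs : ‖s‖ < ε / 2)
    (ht : ‖t‖ ≤ 1) : ‖s * (1 - t)‖ < ε := by
  have h₁ := norm_sub_le s (s * t)
  have h₂ := norm_mul_le s t
  rw [mul_sub, mul_one]
  nlinarith [norm_nonneg s]

theorem norm_add_sub_mul_lt {A : Type*} [NormedRing A] {s t : A} {κ : ℝ} (hκ : κ ≤ 1 / 2)
    (hs : ‖s‖ < κ / 16) (ht : ‖t‖ < κ / 8) : ‖s + t - s * t‖ < κ / 4 := by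
  have h₁ := norm_sub_le (s + t) (s * t)
  have h₂ := norm_add_le s t
  have h₃ := norm_mul_le s t
  nlinarith [norm_nonneg s, norm_nonneg t]

/-- One improvement step: an approximate factorization `(1 - x) U ≈ 1 - y` can be replaced by one
with half the error, without leaving a fixed neighbourhood of the identity.  The two factors are
first corrected by splitting the error, then brought back close to `1` by dividing both of them by
a common unit of the fibre product of `A₁` and `A₂`. -/
theorem exists_halved_factorization_error {κ δ : ℝ} (hκ : κ ≤ 1 / 2)
    (hφ₁ : ∀ x, ‖x‖ < κ → ‖φ₁ x‖ ≤ 1 / 8) (hφ₂ : ∀ x, ‖x‖ < κ → ‖φ₂ x‖ ≤ 1 / 8)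
    (hδ : ∀ c : A₁₂, ‖c‖ < δ → ∃ a b, ‖a‖ < κ / 16 ∧ ‖b‖ < κ / 16 ∧ φ₁ a - φ₂ b = c)
    {U : A₁₂} (hU : ‖U - 1‖ < δ / 8) {x : A₁} {y : A₂} (hx : ‖x‖ < κ / 8) (hy : ‖y‖ < κ / 8)
    (he : ‖φ₁ (1 - x) * U - φ₂ (1 - y)‖ < δ / 4) :
    ∃ x' y', ‖x'‖ < κ / 8 ∧ ‖y'‖ < κ / 8 ∧
      ‖φ₁ (1 - x') * U - φ₂ (1 - y')‖ ≤ 1 / 2 * ‖φ₁ (1 - x) * U - φ₂ (1 - y)‖ := by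
  have hκ0 : 0 < κ := by linarith [norm_nonneg x]
  have hδ0 : 0 < δ := by linarith [norm_nonneg (U - 1)]
  set e := φ₁ (1 - x) * U - φ₂ (1 - y) with he_def
  obtain ⟨c, hc, hc'⟩ := exists_mul_one_sub_eq (r := φ₂ y)
    ((hφ₂ y (by linarith)).trans (by norm_num)) e
  obtain ⟨a, b, ha, hb, hab⟩ := hδ c (by linarith)
  obtain ⟨p, hp_def⟩ : ∃ p, p = a + x - a * x := ⟨_, rfl⟩
  obtain ⟨q, hq_def⟩ : ∃ q, q = b + y - b * y := ⟨_, rfl⟩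
  have hp : ‖p‖ < κ / 4 := hp_def ▸ norm_add_sub_mul_lt hκ ha hx
  have hq : ‖q‖ < κ / 4 := hq_def ▸ norm_add_sub_mul_lt hκ hb hy
  have hp₁ : φ₁ (1 - p) = (1 - φ₁ a) * φ₁ (1 - x) := by
    rw [hp_def, ← map_one φ₁, ← map_sub, ← map_mul]; congr 1; noncomm_ring
  have hq₁ : φ₂ (1 - q) = (1 - φ₂ b) * φ₂ (1 - y) := by
    rw [hq_def, ← map_one φ₂, ← map_sub, ← map_mul]; congr 1; noncomm_ring
  have herr : φ₁ (1 - p) * U - φ₂ (1 - q) = -(φ₁ a * e) := by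
    have hsplit : (φ₁ a - φ₂ b) * φ₂ (1 - y) = e := by
      rw [hab, map_sub, map_one, hc]
    calc φ₁ (1 - p) * U - φ₂ (1 - q)
        = e - φ₁ a * e - (φ₁ a - φ₂ b) * φ₂ (1 - y) := by
          rw [hp₁, hq₁, he_def]; noncomm_ring
      _ = -(φ₁ a * e) := by rw [hsplit]; abel
  have hae : ‖φ₁ a * e‖ ≤ 1 / 8 * ‖e‖ :=
    (norm_mul_le _ _).trans (by gcongr; exact hφ₁ a (by linarith))
  have hdiff : ‖φ₁ p - φ₂ q‖ < δ := by
    have heq : φ₁ p - φ₂ q = φ₁ a * e + ((U - 1) - φ₁ p * (U - 1)) := by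
      calc φ₁ p - φ₂ q
          = -(φ₁ (1 - p) * U - φ₂ (1 - q)) + ((U - 1) - φ₁ p * (U - 1)) := by
            simp only [map_sub, map_one]; noncomm_ring
        _ = φ₁ a * e + ((U - 1) - φ₁ p * (U - 1)) := by rw [herr, neg_neg]
    have h₁ := norm_add_le (φ₁ a * e) ((U - 1) - φ₁ p * (U - 1))
    have h₂ := norm_sub_le (U - 1) (φ₁ p * (U - 1))
    have h₃ := norm_mul_le (φ₁ p) (U - 1)
    have h₄ := hφ₁ p (by linarith)
    rw [heq]
    nlinarith [norm_nonneg (U - 1)]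
  obtain ⟨p', q', hp', hq', hpq⟩ := hδ _ hdiff
  have hr₁ : ‖p - p'‖ < κ / 2 := (norm_sub_le _ _).trans_lt (by linarith)
  have hr₂ : ‖q - q'‖ < κ / 2 := (norm_sub_le _ _).trans_lt (by linarith)
  have hr : φ₂ (q - q') = φ₁ (p - p') := by
    rw [map_sub, map_sub, ← sub_eq_zero]
    rw [← sub_eq_zero] at hpq
    rw [← hpq]; abel
  obtain ⟨x', hx', hx'_norm⟩ := exists_one_sub_mul_eq (r := p - p') (by linarith) p'
  obtain ⟨y', hy', hy'_norm⟩ := exists_one_sub_mul_eq (r := q - q') (by linarith) q'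
  refine ⟨x', y', by linarith, by linarith, ?_⟩
  have hx'' : (1 - (p - p')) * (1 - x') = 1 - p := by rw [mul_sub, hx']; noncomm_ring
  have hy'' : (1 - (q - q')) * (1 - y') = 1 - q := by rw [mul_sub, hy']; noncomm_ring
  have hfinal : (1 - φ₁ (p - p')) * (φ₁ (1 - x') * U - φ₂ (1 - y')) = -(φ₁ a * e) := by
    rw [← herr, ← hx'', ← hy'', map_mul, map_mul, map_sub φ₁ 1 (p - p'), map_sub φ₂ 1 (q - q'), hr,
      map_one, map_one]
    noncomm_ring
  have hle := norm_le_two_mul_norm_one_sub_mul (r := φ₁ (p - p'))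
    ((hφ₁ _ (by linarith)).trans (by norm_num)) (φ₁ (1 - x') * U - φ₂ (1 - y'))
  rw [hfinal, norm_neg] at hle
  linarith [norm_nonneg e]

/-- If `A₁ × A₂ → A₁₂`, `(a, b) ↦ φ₁ a - φ₂ b`, is open at the origin, then every element of `A₁₂`
close to `1` is, up to a unit of `A₁`, a unit of `A₂`. -/
theorem exists_units_map_mul_eq_of_norm_sub_one_lt (hφ₁ : Continuous φ₁) (hφ₂ : Continuous φ₂)
    (hopen : ∀ ε > 0, ∃ δ > 0, ∀ c : A₁₂, ‖c‖ < δ →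
      ∃ a b, ‖a‖ < ε ∧ ‖b‖ < ε ∧ φ₁ a - φ₂ b = c) :
    ∃ δ > 0, ∀ U : A₁₂, ‖U - 1‖ < δ → ∃ (u₁ : A₁ˣ) (u₂ : A₂ˣ), φ₁ u₁ * U = φ₂ u₂ := by
  obtain ⟨κ₁, hκ₁, hκ₁'⟩ := Metric.continuousAt_iff.1 (hφ₁.continuousAt (x := 0)) (1 / 8)
    (by norm_num)
  obtain ⟨κ₂, hκ₂, hκ₂'⟩ := Metric.continuousAt_iff.1 (hφ₂.continuousAt (x := 0)) (1 / 8)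
    (by norm_num)
  simp only [dist_zero_right, map_zero] at hκ₁' hκ₂'
  obtain ⟨κ, hκ, hκ_half, hκ_left, hκ_right⟩ : ∃ κ > 0, κ ≤ 1 / 2 ∧ κ ≤ κ₁ ∧ κ ≤ κ₂ :=
    ⟨min (1 / 2) (min κ₁ κ₂), by positivity, min_le_left _ _,
      (min_le_right _ _).trans (min_le_left _ _), (min_le_right _ _).trans (min_le_right _ _)⟩
  have hb₁ : ∀ x, ‖x‖ < κ → ‖φ₁ x‖ ≤ 1 / 8 := fun x hx => (hκ₁' (hx.trans_le hκ_left)).le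
  have hb₂ : ∀ x, ‖x‖ < κ → ‖φ₂ x‖ ≤ 1 / 8 := fun x hx => (hκ₂' (hx.trans_le hκ_right)).le
  obtain ⟨δ, hδ, hδ'⟩ := hopen (κ / 16) (by positivity)
  have hmod : ∀ ε : ℝ, ∃ η > 0, 0 < ε → ∀ c : A₁₂, ‖c‖ < η →
      ∃ a b, ‖a‖ < min (ε / 2) κ ∧ ‖b‖ < min (ε / 2) κ ∧ φ₁ a - φ₂ b = c := by
    intro ε
    by_cases hε : 0 < ε
    · obtain ⟨η, hη, hη'⟩ := hopen (min (ε / 2) κ) (by positivity)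
      exact ⟨η, hη, fun _ => hη'⟩
    · exact ⟨1, one_pos, fun hε' => absurd hε' hε⟩
  choose η hη hη' using hmod
  refine ⟨min (δ / 8) (η (1 / 2 / 4) / 2), lt_min (by positivity) (half_pos (hη _)),
    fun U hU_lt => ?_⟩
  have hU := hU_lt.trans_le (min_le_left _ _)
  have happrox : ∀ k : ℕ, ∃ x y, ‖x‖ < κ / 8 ∧ ‖y‖ < κ / 8 ∧
      ‖φ₁ (1 - x) * U - φ₂ (1 - y)‖ ≤ (1 / 2) ^ k * (δ / 8) := by
    intro k
    induction k with
    | zero => exact ⟨0, 0, by simpa using hκ, by simpa using hκ, by simpa using hU.le⟩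
    | succ k ih =>
      obtain ⟨x, y, hx, hy, he⟩ := ih
      have hpow : (1 / 2 : ℝ) ^ k ≤ 1 := pow_le_one₀ (by norm_num) (by norm_num)
      obtain ⟨x', y', hx', hy', he'⟩ := exists_halved_factorization_error hκ_half hb₁ hb₂ hδ' hU
        hx hy (he.trans_lt (by nlinarith))
      exact ⟨x', y', hx', hy', he'.trans (by rw [pow_succ]; linarith)⟩
  have hsmall : ∀ θ > 0, ∃ x y, ‖x‖ < κ / 8 ∧ ‖y‖ < κ / 8 ∧
      ‖φ₁ (1 - x) * U - φ₂ (1 - y)‖ < θ := by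
    intro θ hθ
    obtain ⟨k, hk⟩ := exists_pow_lt_of_lt_one (show 0 < θ / (δ / 8) by positivity)
      (show (1 / 2 : ℝ) < 1 by norm_num)
    obtain ⟨x, y, hx, hy, he⟩ := happrox k
    exact ⟨x, y, hx, hy, he.trans_lt ((lt_div_iff₀ (by positivity)).1 hk)⟩
  let S : A₁ × A₂ →+ A₁₂ :=
    ((AddMonoidHom.mulRight U).comp φ₁.toAddMonoidHom).comp (AddMonoidHom.fst A₁ A₂)
      - φ₂.toAddMonoidHom.comp (AddMonoidHom.snd A₁ A₂)
  have hS : ∀ z, S z = φ₁ z.1 * U - φ₂ z.2 := fun z => rfl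
  have hS_cont : Continuous S := by
    change Continuous fun z : A₁ × A₂ => φ₁ z.1 * U - φ₂ z.2
    fun_prop
  have hnearly : ∀ ε > 0, ∀ c : A₁₂, ‖c‖ < η ε / 2 → ∀ θ > 0,
      ∃ z, ‖z‖ < ε ∧ ‖c - S z‖ < θ := by
    intro ε hε c hc θ hθ
    obtain ⟨x, y, hx, hy, he⟩ := hsmall θ hθ
    obtain ⟨c', hc', hc'_norm⟩ := exists_mul_one_sub_eq (r := φ₂ y)
      ((hb₂ y (by linarith)).trans (by norm_num)) c
    obtain ⟨a, b, ha, hb, hab⟩ := hη' ε hε c' (by linarith)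
    refine ⟨(a * (1 - x), b * (1 - y)), ?_, ?_⟩
    · rw [Prod.norm_def]
      exact max_lt (norm_mul_one_sub_lt (ha.trans_le (min_le_left _ _)) (by linarith))
        (norm_mul_one_sub_lt (hb.trans_le (min_le_left _ _)) (by linarith))
    · have herr : c - S (a * (1 - x), b * (1 - y))
          = -(φ₁ a * (φ₁ (1 - x) * U - φ₂ (1 - y))) := by
        have hc'' : (φ₁ a - φ₂ b) * φ₂ (1 - y) = c := by rw [hab, map_sub, map_one, hc']
        rw [hS, ← hc'', map_mul, map_mul]; noncomm_ring
      have h₁ := norm_mul_le (φ₁ a) (φ₁ (1 - x) * U - φ₂ (1 - y))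
      have h₂ := hb₁ a (ha.trans_le (min_le_right _ _))
      rw [herr, norm_neg]
      nlinarith [norm_nonneg (φ₁ (1 - x) * U - φ₂ (1 - y))]
  obtain ⟨⟨x, y⟩, hxy, hxy'⟩ := exists_norm_lt_map_eq_of_nearly_open S hS_cont
    (δ := fun ε => η ε / 2) (fun ε _ => half_pos (hη ε)) hnearly (show (0 : ℝ) < 1 / 2 by norm_num)
    (hU_lt.trans_le (min_le_right _ _))
  rw [Prod.norm_def, max_lt_iff] at hxy
  refine ⟨Units.oneSub x (hxy.1.trans (by norm_num)), Units.oneSub y (hxy.2.trans (by norm_num)), ?_⟩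
  rw [hS] at hxy'
  calc φ₁ (1 - x) * U = U - (φ₁ x * U - φ₂ y) - φ₂ y := by rw [map_sub, map_one]; noncomm_ring
    _ = φ₂ (1 - y) := by rw [hxy', map_sub, map_one]; abel

end Factorization

section SwapMatrix

open Matrix

/-- The product of elementary block matrices whose value is `!![1 - B A, -B; A, 1 - A B]` as soon
as `B A B = B`; if moreover `A B A = A`, it maps the image of `B A` onto that of `A B`. -/
def swapMatrix {m n S : Type*} [Fintype m] [Fintype n] [DecidableEq m] [DecidableEq n]
    [CommRing S] (A : Matrix m n S) (B : Matrix n m S) : Matrix (n ⊕ m) (n ⊕ m) S :=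
  fromBlocks 1 (-B) 0 1 * fromBlocks 1 0 A 1 * fromBlocks 1 (-B) 0 1

theorem denseRange_matrix_map {m n S S' : Type*} [TopologicalSpace S'] {f : S → S'}
    (hf : DenseRange f) : DenseRange fun A : Matrix m n S => A.map f :=
  DenseRange.piMap fun _ => DenseRange.piMap fun _ => hf

variable {m n S : Type*} [Fintype m] [Fintype n] [DecidableEq m] [DecidableEq n] [CommRing S]

theorem swapMatrix_mul_swapMatrix_neg (A : Matrix m n S) (B : Matrix n m S) :
    swapMatrix A B * swapMatrix (-A) (-B) = 1 := by
  have h₁ : fromBlocks 1 (-B) 0 1 * fromBlocks 1 B 0 1 = (1 : Matrix (n ⊕ m) (n ⊕ m) S) := by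
    simp [fromBlocks_multiply]
  have h₂ : fromBlocks 1 0 A 1 * fromBlocks 1 0 (-A) 1 = (1 : Matrix (n ⊕ m) (n ⊕ m) S) := by
    simp [fromBlocks_multiply]
  rw [swapMatrix, swapMatrix, neg_neg]
  generalize (fromBlocks 1 (-B) 0 1 : Matrix (n ⊕ m) (n ⊕ m) S) = T,
    (fromBlocks 1 B 0 1 : Matrix (n ⊕ m) (n ⊕ m) S) = T',
    (fromBlocks 1 0 A 1 : Matrix (n ⊕ m) (n ⊕ m) S) = L,
    (fromBlocks 1 0 (-A) 1 : Matrix (n ⊕ m) (n ⊕ m) S) = L' at h₁ h₂ ⊢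
  calc T * L * T * (T' * L' * T') = T * (L * (T * T') * L') * T' := by
        simp only [Matrix.mul_assoc]
    _ = 1 := by rw [h₁, Matrix.mul_one, h₂, Matrix.mul_one, h₁]

theorem swapMatrix_neg_mul_swapMatrix (A : Matrix m n S) (B : Matrix n m S) :
    swapMatrix (-A) (-B) * swapMatrix A B = 1 :=
  mul_eq_one_comm.1 (swapMatrix_mul_swapMatrix_neg A B)

theorem swapMatrix_eq_fromBlocks {A : Matrix m n S} {B : Matrix n m S} (hB : B * A * B = B) :
    swapMatrix A B = fromBlocks (1 - B * A) (-B) A (1 - A * B) := by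
  simp only [swapMatrix, fromBlocks_multiply, Matrix.mul_neg, Matrix.neg_mul, Matrix.mul_one,
    Matrix.one_mul, Matrix.mul_zero, zero_add, add_zero, Matrix.add_mul, hB]
  congr 1 <;> abel

theorem map_swapMatrix {S' : Type*} [CommRing S'] (φ : S →+* S') (A : Matrix m n S)
    (B : Matrix n m S) : φ.mapMatrix (swapMatrix A B) = swapMatrix (A.map φ) (B.map φ) := by
  simp [swapMatrix, fromBlocks_map, Matrix.map_neg]

theorem continuous_swapMatrix [TopologicalSpace S] [IsTopologicalRing S] :
    Continuous fun P : Matrix m n S × Matrix n m S => swapMatrix P.1 P.2 := by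
  unfold swapMatrix
  fun_prop

end SwapMatrix

section MatrixFactorization

attribute [local instance] Matrix.linftyOpNormedRing

theorem Matrix.completeSpace_linftyOp {ι R : Type*} [Fintype ι] [DecidableEq ι]
    [NormedCommRing R] [CompleteSpace R] :
    @CompleteSpace (Matrix ι ι R) PseudoMetricSpace.toUniformSpace :=
  inferInstanceAs (CompleteSpace (ι → ι → R))

variable {ι R₁ R₂ R₁₂ : Type*} [Fintype ι] [DecidableEq ι]
  [NormedCommRing R₁] [NormedCommRing R₂] [NormedCommRing R₁₂]

theorem Matrix.norm_apply_le_linfty_opNorm (A : Matrix ι ι R₁) (i j : ι) : ‖A i j‖ ≤ ‖A‖ := by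
  rw [Matrix.linfty_opNorm_def, ← coe_nnnorm, NNReal.coe_le_coe]
  exact (Finset.single_le_sum (f := fun j => ‖A i j‖₊) (fun _ _ => zero_le)
    (Finset.mem_univ j)).trans (Finset.le_sup (f := fun i => ∑ j, ‖A i j‖₊) (Finset.mem_univ i))

theorem Matrix.linfty_opNorm_lt {A : Matrix ι ι R₁} {ε : ℝ} (hε : 0 < ε)
    (h : ∀ i j, ‖A i j‖ < ε / (Fintype.card ι + 1)) : ‖A‖ < ε := by
  lift ε to NNReal using hε.le
  rw [Matrix.linfty_opNorm_def, NNReal.coe_lt_coe, Finset.sup_lt_iff (by exact_mod_cast hε)]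
  intro i _
  have hsum : ∑ j, ‖A i j‖ ≤ Fintype.card ι * (ε / (Fintype.card ι + 1)) := by
    simpa using Finset.sum_le_card_nsmul Finset.univ (fun j => ‖A i j‖) _ (fun j _ => (h i j).le)
  rw [← NNReal.coe_lt_coe, NNReal.coe_sum]
  refine hsum.trans_lt ?_
  rw [mul_div_assoc', div_lt_iff₀ (by positivity)]
  linarith

theorem Matrix.exists_norm_lt_map_sub_map_eq {φ₁ : R₁ →+* R₁₂} {φ₂ : R₂ →+* R₁₂}
    (hopen : IsOpenMap fun p : R₁ × R₂ => φ₁ p.1 - φ₂ p.2) {ε : ℝ} (hε : 0 < ε) :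
    ∃ δ > 0, ∀ C : Matrix ι ι R₁₂, ‖C‖ < δ → ∃ A B, ‖A‖ < ε ∧ ‖B‖ < ε ∧
      φ₁.mapMatrix A - φ₂.mapMatrix B = C := by
  have hε' : 0 < ε / (Fintype.card ι + 1) := by positivity
  have hnhds := hopen.image_mem_nhds (Metric.ball_mem_nhds (0 : R₁ × R₂) hε')
  simp only [Prod.fst_zero, Prod.snd_zero, map_zero, sub_zero] at hnhds
  obtain ⟨δ, hδ, hball⟩ := Metric.mem_nhds_iff.1 hnhds
  refine ⟨δ, hδ, fun C hC => ?_⟩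
  have hentry : ∀ i j, ∃ p : R₁ × R₂, ‖p‖ < ε / (Fintype.card ι + 1) ∧
      φ₁ p.1 - φ₂ p.2 = C i j := fun i j => by
    obtain ⟨p, hp, hpC⟩ := hball
      (mem_ball_zero_iff.2 ((C.norm_apply_le_linfty_opNorm i j).trans_lt hC))
    exact ⟨p, mem_ball_zero_iff.1 hp, hpC⟩
  choose p hp hpC using hentry
  exact ⟨Matrix.of fun i j => (p i j).1, Matrix.of fun i j => (p i j).2,
    Matrix.linfty_opNorm_lt hε fun i j => (norm_fst_le _).trans_lt (hp i j),
    Matrix.linfty_opNorm_lt hε fun i j => (norm_snd_le _).trans_lt (hp i j),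
    Matrix.ext hpC⟩

theorem Matrix.exists_units_map_mul_swapMatrix_eq {m n : Type*} [Fintype m] [Fintype n]
    [DecidableEq m] [DecidableEq n] [CompleteSpace R₁] [CompleteSpace R₂] [CompleteSpace R₁₂]
    {φ₁ : R₁ →+* R₁₂} {φ₂ : R₂ →+* R₁₂} (hφ₁ : Continuous φ₁) (hφ₂ : Continuous φ₂)
    (hopen : IsOpenMap fun p : R₁ × R₂ => φ₁ p.1 - φ₂ p.2) (hdense : DenseRange φ₂)
    (A : Matrix m n R₁₂) (B : Matrix n m R₁₂) :
    ∃ (g₁ : (Matrix (n ⊕ m) (n ⊕ m) R₁)ˣ) (g₂ : (Matrix (n ⊕ m) (n ⊕ m) R₂)ˣ),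
      φ₂.mapMatrix g₂ * swapMatrix A B = φ₁.mapMatrix g₁ := by
  have := Matrix.completeSpace_linftyOp (ι := n ⊕ m) (R := R₁)
  have := Matrix.completeSpace_linftyOp (ι := n ⊕ m) (R := R₂)
  have := Matrix.completeSpace_linftyOp (ι := n ⊕ m) (R := R₁₂)
  obtain ⟨δ, hδ, hfactor⟩ := exists_units_map_mul_eq_of_norm_sub_one_lt
    (φ₁ := φ₁.mapMatrix (m := n ⊕ m)) (φ₂ := φ₂.mapMatrix)
    (continuous_id.matrix_map hφ₁) (continuous_id.matrix_map hφ₂)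
    (fun ε hε => Matrix.exists_norm_lt_map_sub_map_eq hopen hε)
  have hcont : Continuous fun P : Matrix m n R₁₂ × Matrix n m R₁₂ =>
      swapMatrix (-A) (-B) * swapMatrix P.1 P.2 := continuous_const.matrix_mul continuous_swapMatrix
  obtain ⟨⟨A', B'⟩, hAB⟩ := ((denseRange_matrix_map hdense).prodMap
    (denseRange_matrix_map hdense)).exists_mem_open
    ((Metric.isOpen_ball (x := (1 : Matrix (n ⊕ m) (n ⊕ m) R₁₂)) (ε := δ)).preimage hcont)
    ⟨(A, B), by
      rw [Set.mem_preimage, swapMatrix_neg_mul_swapMatrix]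
      exact Metric.mem_ball_self hδ⟩
  rw [Set.mem_preimage, mem_ball_iff_norm] at hAB
  obtain ⟨u₁, u₂, hu⟩ := hfactor _ hAB
  let v : (Matrix (n ⊕ m) (n ⊕ m) R₂)ˣ := ⟨swapMatrix A' B', swapMatrix (-A') (-B'),
    swapMatrix_mul_swapMatrix_neg _ _, swapMatrix_neg_mul_swapMatrix _ _⟩
  have hv : φ₂.mapMatrix v = swapMatrix (A'.map φ₂) (B'.map φ₂) := map_swapMatrix _ _ _
  refine ⟨u₁, u₂ * v⁻¹, ?_⟩
  have hv_inv : φ₂.mapMatrix v * φ₂.mapMatrix (v⁻¹).val = 1 := by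
    rw [← map_mul, Units.mul_inv, map_one]
  rw [Units.val_mul, map_mul, ← hu]
  simp only [Prod.map_fst, Prod.map_snd]
  rw [← hv]
  simp only [mul_assoc]
  rw [← mul_assoc (φ₂.mapMatrix _) (φ₂.mapMatrix _), hv_inv, one_mul,
    swapMatrix_neg_mul_swapMatrix, mul_one]

end MatrixFactorization

section SwapRetract

open Matrix

variable {m n S V₁ V₂ : Type*} [Fintype m] [Fintype n] [DecidableEq m] [DecidableEq n]
  [CommRing S] [AddCommGroup V₁] [Module S V₁] [AddCommGroup V₂] [Module S V₂]

/-- If `V₁` and `V₂` are retracts of `Sⁿ` and `Sᵐ`, then an isomorphism `V₁ ≃ V₂` is induced by an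
automorphism of `Sⁿ ⊕ Sᵐ` of the form `swapMatrix A B`. -/
theorem exists_swapMatrix_of_retract (ψ : V₁ ≃ₗ[S] V₂)
    {i₁ : V₁ →ₗ[S] n → S} {q₁ : (n → S) →ₗ[S] V₁} (h₁ : q₁ ∘ₗ i₁ = LinearMap.id)
    {i₂ : V₂ →ₗ[S] m → S} {q₂ : (m → S) →ₗ[S] V₂} (h₂ : q₂ ∘ₗ i₂ = LinearMap.id) :
    ∃ (A : Matrix m n S) (B : Matrix n m S),
      (∀ x, swapMatrix A B *ᵥ Sum.elim (i₁ x) 0 = Sum.elim (0 : n → S) (i₂ (ψ x))) ∧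
      ∀ z, ψ (q₁ (z ∘ Sum.inl)) = q₂ ((swapMatrix A B *ᵥ z) ∘ Sum.inr) := by
  replace h₁ := LinearMap.congr_fun h₁
  replace h₂ := LinearMap.congr_fun h₂
  simp only [LinearMap.comp_apply, LinearMap.id_apply] at h₁ h₂
  refine ⟨LinearMap.toMatrix' (i₂ ∘ₗ ψ.toLinearMap ∘ₗ q₁),
    LinearMap.toMatrix' (i₁ ∘ₗ ψ.symm.toLinearMap ∘ₗ q₂), ?_, ?_⟩
  all_goals rw [swapMatrix_eq_fromBlocks (by
    simp only [← LinearMap.toMatrix'_comp]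
    congr 1; ext : 2; simp [h₁, h₂])]
  · intro x
    simp [fromBlocks_mulVec, sub_mulVec, ← LinearMap.toMatrix'_comp, LinearMap.toMatrix'_mulVec,
      h₁, h₂]
  · intro z
    simp [fromBlocks_mulVec, sub_mulVec, ← LinearMap.toMatrix'_comp, LinearMap.toMatrix'_mulVec,
      h₁, h₂]

end SwapRetract

theorem Module.exists_retract_baseChange (S S' M : Type*) [CommRing S] [CommRing S'] [Algebra S S']
    [AddCommGroup M] [Module S M] [Module.Finite S M] [Module.Projective S M] :
    ∃ (n : ℕ) (i : M →ₗ[S] Fin n → S) (q : (Fin n → S) →ₗ[S] M)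
      (i' : S' ⊗[S] M →ₗ[S'] Fin n → S') (q' : (Fin n → S') →ₗ[S'] S' ⊗[S] M),
      q ∘ₗ i = LinearMap.id ∧ q' ∘ₗ i' = LinearMap.id ∧
      (∀ x, i' (1 ⊗ₜ x) = algebraMap S S' ∘ i x) ∧
      ∀ v, q' (algebraMap S S' ∘ v) = 1 ⊗ₜ q v := by
  obtain ⟨n, q, i, -, -, hqi⟩ := Module.Finite.exists_comp_eq_id_of_projective S M
  let e := TensorProduct.piScalarRight S S' S' (Fin n)
  have he : ∀ v : Fin n → S, e (1 ⊗ₜ v) = algebraMap S S' ∘ v := fun v => by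
    ext j
    simp [e, Algebra.smul_def]
  refine ⟨n, i, q, e.toLinearMap ∘ₗ i.baseChange S', q.baseChange S' ∘ₗ e.symm.toLinearMap, hqi,
    ?_, ?_, ?_⟩
  · ext x
    simpa using congrArg ((1 : S') ⊗ₜ[S] ·) (LinearMap.congr_fun hqi x)
  · intro x
    simp [he]
  · intro v
    simp [← he]

theorem LinearMap.bijective_liftBaseChange_of_retract {R S N M ι : Type*} [CommRing R] [CommRing S]
    [Algebra R S] [AddCommGroup N] [Module R N] [AddCommGroup M] [Module R M] [Module S M]
    [IsScalarTower R S M] [Fintype ι] [DecidableEq ι] (f : N →ₗ[R] M)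
    {s : N →ₗ[R] ι → R} {p : (ι → R) →ₗ[R] N} (hps : p ∘ₗ s = LinearMap.id)
    {s' : M →ₗ[S] ι → S} {p' : (ι → S) →ₗ[S] M} (hps' : p' ∘ₗ s' = LinearMap.id)
    (hs : ∀ x i, algebraMap R S (s x i) = s' (f x) i)
    (hp : ∀ i, f (p (Pi.single i 1)) = p' (Pi.single i 1)) :
    Function.Bijective (f.liftBaseChange S) := by
  let g : M →ₗ[S] S ⊗[R] N :=
    Fintype.linearCombination S (fun i => 1 ⊗ₜ[R] p (Pi.single i 1)) ∘ₗ s'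
  have hg : ∀ x, g x = ∑ i, s' x i • (1 ⊗ₜ[R] p (Pi.single i 1)) := fun x => rfl
  have hleft : g ∘ₗ f.liftBaseChange S = LinearMap.id := by
    ext x
    have hx : ∑ i, s x i • p (Pi.single i 1) = x := by
      simp only [← map_smul, ← map_sum, ← pi_eq_sum_univ']
      exact LinearMap.congr_fun hps x
    conv_rhs => rw [← hx]
    simp [hg, ← hs]
  have hright : f.liftBaseChange S ∘ₗ g = LinearMap.id := by
    ext x
    simp only [LinearMap.comp_apply, hg, map_sum, map_smul, liftBaseChange_tmul, one_smul, hp]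
    simp only [← map_smul, ← map_sum, ← pi_eq_sum_univ']
    exact LinearMap.congr_fun hps' x
  exact ⟨Function.LeftInverse.injective (g := g) (LinearMap.congr_fun hleft),
    Function.RightInverse.surjective (g := g) (LinearMap.congr_fun hright)⟩

section GluedRetract

variable {R R₁ R₂ R₁₂ M₁ M₂ ι : Type*}
  [CommRing R] [CommRing R₁] [CommRing R₂] [CommRing R₁₂]
  [Algebra R R₁] [Algebra R R₂] [Algebra R R₁₂] [Algebra R₁ R₁₂] [Algebra R₂ R₁₂]
  [IsScalarTower R R₁ R₁₂] [IsScalarTower R R₂ R₁₂]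
  [AddCommGroup M₁] [Module R₁ M₁] [Module R M₁] [IsScalarTower R R₁ M₁]
  [AddCommGroup M₂] [Module R₂ M₂] [Module R M₂] [IsScalarTower R R₂ M₂]
  {ψ : (R₁₂ ⊗[R₁] M₁) ≃ₗ[R₁₂] (R₁₂ ⊗[R₂] M₂)}

theorem mem_gluedModule {x : M₁ × M₂} :
    x ∈ gluedModule R ψ ↔ ψ (1 ⊗ₜ x.1) = 1 ⊗ₜ x.2 :=
  sub_eq_zero

/-- Over a fibre product `R` of `R₁` and `R₂`, compatible presentations of `M₁` and `M₂` as retracts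
of free modules of the same rank glue to such a presentation of the equalizer module. -/
theorem gluedModule_finite_projective_of_retract [Fintype ι] [DecidableEq ι]
    (hinj : Function.Injective fun r : R => (algebraMap R R₁ r, algebraMap R R₂ r))
    (hexact : ∀ (a : R₁) (b : R₂), algebraMap R₁ R₁₂ a = algebraMap R₂ R₁₂ b →
      ∃ r : R, algebraMap R R₁ r = a ∧ algebraMap R R₂ r = b)
    {s₁ : M₁ →ₗ[R₁] ι → R₁} {p₁ : (ι → R₁) →ₗ[R₁] M₁} (hps₁ : p₁ ∘ₗ s₁ = LinearMap.id)
    {s₂ : M₂ →ₗ[R₂] ι → R₂} {p₂ : (ι → R₂) →ₗ[R₂] M₂} (hps₂ : p₂ ∘ₗ s₂ = LinearMap.id)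
    (hs : ∀ x ∈ gluedModule R ψ, ∀ i,
      algebraMap R₁ R₁₂ (s₁ x.1 i) = algebraMap R₂ R₁₂ (s₂ x.2 i))
    (hp : ∀ i, (p₁ (Pi.single i 1), p₂ (Pi.single i 1)) ∈ gluedModule R ψ) :
    Module.Finite R (gluedModule R ψ) ∧ Module.Projective R (gluedModule R ψ) ∧
    Function.Bijective (LinearMap.liftBaseChange R₁
      ((LinearMap.fst R M₁ M₂).comp (gluedModule R ψ).subtype)) ∧
    Function.Bijective (LinearMap.liftBaseChange R₂
      ((LinearMap.snd R M₁ M₂).comp (gluedModule R ψ).subtype)) := by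
  choose r hr₁ hr₂ using fun (x : gluedModule R ψ) i => hexact _ _ (hs x x.2 i)
  let s : gluedModule R ψ →ₗ[R] ι → R :=
    { toFun := r
      map_add' := fun x y => by
        ext i
        exact hinj (by simp [hr₁, hr₂])
      map_smul' := fun a x => by
        ext i
        apply hinj
        simp only [hr₁, hr₂, Pi.smul_apply, smul_eq_mul, map_mul, RingHom.id_apply,
          Submodule.coe_smul, Prod.smul_fst, Prod.smul_snd, LinearMap.map_smul_of_tower,
          Algebra.smul_def] }
  let p : (ι → R) →ₗ[R] gluedModule R ψ :=
    Fintype.linearCombination R fun i => ⟨(p₁ (Pi.single i 1), p₂ (Pi.single i 1)), hp i⟩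
  have hp_single : ∀ i, p (Pi.single i 1) = ⟨(p₁ (Pi.single i 1), p₂ (Pi.single i 1)), hp i⟩ :=
    fun i => by simp [p]
  have hps : p ∘ₗ s = LinearMap.id := by
    ext x
    · refine Eq.trans ?_ (LinearMap.congr_fun hps₁ x.1.1)
      conv_rhs => rw [LinearMap.comp_apply, pi_eq_sum_univ' (s₁ x.1.1)]
      simp [p, s, ← hr₁, Fintype.linearCombination_apply, Prod.fst_sum]
    · refine Eq.trans ?_ (LinearMap.congr_fun hps₂ x.1.2)
      conv_rhs => rw [LinearMap.comp_apply, pi_eq_sum_univ' (s₂ x.1.2)]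
      simp [p, s, ← hr₂, Fintype.linearCombination_apply, Prod.snd_sum]
  refine ⟨Module.Finite.of_surjective p fun x => ⟨s x, LinearMap.congr_fun hps x⟩,
    Module.Projective.of_split s p hps, ?_, ?_⟩
  · exact LinearMap.bijective_liftBaseChange_of_retract _ hps hps₁ hr₁ fun i => by
      simp [hp_single]
  · exact LinearMap.bijective_liftBaseChange_of_retract _ hps hps₂ hr₂ fun i => by
      simp [hp_single]

end GluedRetract

theorem Matrix.comp_mulVec_single_one {ι S S' : Type*} [Fintype ι] [DecidableEq ι] [CommRing S]
    [CommRing S'] (φ : S →+* S') (g : Matrix ι ι S) (j : ι) :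
    φ ∘ g.mulVec (Pi.single j 1) = (φ.mapMatrix g).mulVec (Pi.single j 1) := by
  ext k
  simp

section GluedCoordinates

open Matrix

variable {R R₁ R₂ R₁₂ M₁ M₂ : Type*}
  [CommRing R] [CommRing R₁] [CommRing R₂] [CommRing R₁₂]
  [Algebra R R₁] [Algebra R R₂] [Algebra R R₁₂] [Algebra R₁ R₁₂] [Algebra R₂ R₁₂]
  [IsScalarTower R R₁ R₁₂] [IsScalarTower R R₂ R₁₂]
  [AddCommGroup M₁] [Module R₁ M₁] [Module R M₁] [IsScalarTower R R₁ M₁]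
  [AddCommGroup M₂] [Module R₂ M₂] [Module R M₂] [IsScalarTower R R₂ M₂]
  [Module.Finite R₁ M₁] [Module.Projective R₁ M₁]
  [Module.Finite R₂ M₂] [Module.Projective R₂ M₂]

/-- The algebraic part of the glueing lemma: over a fibre product `R` of `R₁` and `R₂`, finite
projective modules glue as soon as the matrices `swapMatrix A B` over `R₁₂` can be factored. -/
theorem gluedModule_finite_projective_of_factorization
    (ψ : (R₁₂ ⊗[R₁] M₁) ≃ₗ[R₁₂] (R₁₂ ⊗[R₂] M₂))
    (hinj : Function.Injective fun r : R => (algebraMap R R₁ r, algebraMap R R₂ r))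
    (hexact : ∀ (a : R₁) (b : R₂), algebraMap R₁ R₁₂ a = algebraMap R₂ R₁₂ b →
      ∃ r : R, algebraMap R R₁ r = a ∧ algebraMap R R₂ r = b)
    (hfactor : ∀ (m n : ℕ) (A : Matrix (Fin m) (Fin n) R₁₂) (B : Matrix (Fin n) (Fin m) R₁₂),
      ∃ (g₁ : (Matrix (Fin n ⊕ Fin m) (Fin n ⊕ Fin m) R₁)ˣ)
        (g₂ : (Matrix (Fin n ⊕ Fin m) (Fin n ⊕ Fin m) R₂)ˣ),
        (algebraMap R₂ R₁₂).mapMatrix g₂ * swapMatrix A B = (algebraMap R₁ R₁₂).mapMatrix g₁) :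
    Module.Finite R (gluedModule R ψ) ∧ Module.Projective R (gluedModule R ψ) ∧
    Function.Bijective (LinearMap.liftBaseChange R₁
      ((LinearMap.fst R M₁ M₂).comp (gluedModule R ψ).subtype)) ∧
    Function.Bijective (LinearMap.liftBaseChange R₂
      ((LinearMap.snd R M₁ M₂).comp (gluedModule R ψ).subtype)) := by
  obtain ⟨n, i₁, q₁, I₁, Q₁, h₁, H₁, hI₁, hQ₁⟩ := Module.exists_retract_baseChange R₁ R₁₂ M₁
  obtain ⟨m, i₂, q₂, I₂, Q₂, h₂, H₂, hI₂, hQ₂⟩ := Module.exists_retract_baseChange R₂ R₁₂ M₂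
  obtain ⟨A, B, hAB, hAB'⟩ := exists_swapMatrix_of_retract ψ H₁ H₂
  obtain ⟨g₁, g₂, hg⟩ := hfactor m n A B
  have hg' : swapMatrix A B * (algebraMap R₁ R₁₂).mapMatrix (g₁⁻¹).val =
      (algebraMap R₂ R₁₂).mapMatrix (g₂⁻¹).val := by
    have e₁ : (algebraMap R₁ R₁₂).mapMatrix g₁.val * (algebraMap R₁ R₁₂).mapMatrix (g₁⁻¹).val =
        1 := by
      rw [← map_mul, Units.mul_inv, map_one]
    have e₂ : (algebraMap R₂ R₁₂).mapMatrix (g₂⁻¹).val * (algebraMap R₂ R₁₂).mapMatrix g₂.val =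
        1 := by
      rw [← map_mul, Units.inv_mul, map_one]
    rw [← hg, mul_assoc] at e₁
    exact (left_inv_eq_right_inv e₂ e₁).symm
  let E₁ := LinearEquiv.sumArrowLequivProdArrow (Fin n) (Fin m) R₁ R₁
  let E₂ := LinearEquiv.sumArrowLequivProdArrow (Fin n) (Fin m) R₂ R₂
  let s₁ : M₁ →ₗ[R₁] Fin n ⊕ Fin m → R₁ :=
    Matrix.toLin' g₁.val ∘ₗ E₁.symm.toLinearMap ∘ₗ LinearMap.inl R₁ _ _ ∘ₗ i₁
  let p₁ : (Fin n ⊕ Fin m → R₁) →ₗ[R₁] M₁ :=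
    q₁ ∘ₗ LinearMap.funLeft R₁ R₁ Sum.inl ∘ₗ Matrix.toLin' (g₁⁻¹).val
  let s₂ : M₂ →ₗ[R₂] Fin n ⊕ Fin m → R₂ :=
    Matrix.toLin' g₂.val ∘ₗ E₂.symm.toLinearMap ∘ₗ LinearMap.inr R₂ _ _ ∘ₗ i₂
  let p₂ : (Fin n ⊕ Fin m → R₂) →ₗ[R₂] M₂ :=
    q₂ ∘ₗ LinearMap.funLeft R₂ R₂ Sum.inr ∘ₗ Matrix.toLin' (g₂⁻¹).val
  have hs₁ : ∀ x, s₁ x = g₁.val *ᵥ Sum.elim (i₁ x) 0 := fun x => rfl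
  have hs₂ : ∀ x, s₂ x = g₂.val *ᵥ Sum.elim 0 (i₂ x) := fun x => rfl
  have hp₁ : ∀ v, p₁ v = q₁ (((g₁⁻¹).val *ᵥ v) ∘ Sum.inl) := fun v => rfl
  have hp₂ : ∀ v, p₂ v = q₂ (((g₂⁻¹).val *ᵥ v) ∘ Sum.inr) := fun v => rfl
  refine gluedModule_finite_projective_of_retract (s₁ := s₁) (p₁ := p₁) (s₂ := s₂) (p₂ := p₂)
    hinj hexact ?_ ?_ ?_ ?_
  · ext x
    simpa [hs₁, hp₁] using LinearMap.congr_fun h₁ x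
  · ext x
    simpa [hs₂, hp₂] using LinearMap.congr_fun h₂ x
  · intro x hx j
    have hx' := hAB (1 ⊗ₜ x.1)
    rw [mem_gluedModule.1 hx, hI₁, hI₂] at hx'
    have hz₁ : algebraMap R₁ R₁₂ ∘ (0 : Fin m → R₁) = 0 := funext fun _ => map_zero _
    have hz₂ : algebraMap R₂ R₁₂ ∘ (0 : Fin n → R₂) = 0 := funext fun _ => map_zero _
    rw [hs₁, hs₂, RingHom.map_mulVec, RingHom.map_mulVec, Sum.comp_elim, Sum.comp_elim, hz₁, hz₂,
      ← hx', mulVec_mulVec, ← RingHom.mapMatrix_apply, ← RingHom.mapMatrix_apply, hg]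
  · intro j
    rw [mem_gluedModule]
    simp only [hp₁, hp₂, ← hQ₁, ← hQ₂, ← Function.comp_assoc,
      Matrix.comp_mulVec_single_one]
    rw [hAB', mulVec_mulVec, hg']

end GluedCoordinates

/-- **The glueing lemma for finite projective modules over a glueing square of commutative
Banach rings** (Kedlaya, Kedlaya–Liu).  Let `R, R₁, R₂, R₁₂` be commutative Banach rings with
continuous ring homomorphisms `R → R₁`, `R → R₂`, `R₁ → R₁₂`, `R₂ → R₁₂` forming a commuting
square (encoded by the algebra and scalar-tower instances), such that
`0 → R → R₁ ⊕ R₂ → R₁₂ → 0` (with maps `r ↦ (r, r)` and `(a, b) ↦ a - b`) is strict exact: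
the first map is a closed topological embedding (hence injective), the kernel of the second map
is exactly the image of the first, and the second map is a continuous open surjection; assume
moreover that `R₂` has dense image in `R₁₂`.  Given finite projective modules `M₁` over `R₁`
and `M₂` over `R₂` and an `R₁₂`-module isomorphism `ψ : M₁ ⊗[R₁] R₁₂ ≅ M₂ ⊗[R₂] R₁₂`
(a descent datum), the equalizer `M = {(m₁, m₂) : ψ(m₁ ⊗ 1) = m₂ ⊗ 1}` is a finite projective
`R`-module and the natural base-change maps `M ⊗[R] R₁ → M₁` and `M ⊗[R] R₂ → M₂` are
isomorphisms. -/
theorem glueing_finite_projective_of_strict_exact_dense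
    (R : Type*) {R₁ R₂ R₁₂ M₁ M₂ : Type*}
    [NormedCommRing R] [NormedCommRing R₁] [NormedCommRing R₂] [NormedCommRing R₁₂]
    [CompleteSpace R] [CompleteSpace R₁] [CompleteSpace R₂] [CompleteSpace R₁₂]
    [Algebra R R₁] [Algebra R R₂] [Algebra R R₁₂]
    [Algebra R₁ R₁₂] [Algebra R₂ R₁₂]
    [IsScalarTower R R₁ R₁₂] [IsScalarTower R R₂ R₁₂]
    -- the four ring homomorphisms are continuous
    (hcont₁ : Continuous (algebraMap R R₁)) (hcont₂ : Continuous (algebraMap R R₂))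
    (hcont₁₂ : Continuous (algebraMap R₁ R₁₂)) (hcont₂₁ : Continuous (algebraMap R₂ R₁₂))
    -- strict exactness of 0 → R → R₁ ⊕ R₂ → R₁₂ → 0 :
    -- the first map is a closed topological embedding (in particular injective)
    (hclosed : Topology.IsClosedEmbedding (fun r : R => (algebraMap R R₁ r, algebraMap R R₂ r)))
    (hinj : Function.Injective (fun r : R => (algebraMap R R₁ r, algebraMap R R₂ r)))
    -- exactness in the middle: the kernel of the second map is the image of the first
    (hexact : ∀ p : R₁ × R₂,
      algebraMap R₁ R₁₂ p.1 - algebraMap R₂ R₁₂ p.2 = 0 ↔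
        ∃ r : R, (algebraMap R R₁ r, algebraMap R R₂ r) = p)
    -- the second map is a continuous open surjection
    (hσcont : Continuous (fun p : R₁ × R₂ => algebraMap R₁ R₁₂ p.1 - algebraMap R₂ R₁₂ p.2))
    (hσopen : IsOpenMap (fun p : R₁ × R₂ => algebraMap R₁ R₁₂ p.1 - algebraMap R₂ R₁₂ p.2))
    (hσsurj : Function.Surjective
      (fun p : R₁ × R₂ => algebraMap R₁ R₁₂ p.1 - algebraMap R₂ R₁₂ p.2))
    -- the image of R₂ in R₁₂ is dense
    (hdense : DenseRange (algebraMap R₂ R₁₂))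
    -- finite projective modules M₁ over R₁ and M₂ over R₂
    [AddCommGroup M₁] [Module R₁ M₁] [Module R M₁] [IsScalarTower R R₁ M₁]
    [AddCommGroup M₂] [Module R₂ M₂] [Module R M₂] [IsScalarTower R R₂ M₂]
    [Module.Finite R₁ M₁] [Module.Projective R₁ M₁]
    [Module.Finite R₂ M₂] [Module.Projective R₂ M₂]
    -- the descent datum: an R₁₂-module isomorphism M₁ ⊗[R₁] R₁₂ ≅ M₂ ⊗[R₂] R₁₂
    (ψ : (R₁₂ ⊗[R₁] M₁) ≃ₗ[R₁₂] (R₁₂ ⊗[R₂] M₂)) :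
    Module.Finite R (gluedModule R ψ) ∧ Module.Projective R (gluedModule R ψ) ∧
    Function.Bijective (LinearMap.liftBaseChange R₁
      ((LinearMap.fst R M₁ M₂).comp (gluedModule R ψ).subtype)) ∧
    Function.Bijective (LinearMap.liftBaseChange R₂
      ((LinearMap.snd R M₁ M₂).comp (gluedModule R ψ).subtype)) := by
  refine gluedModule_finite_projective_of_factorization ψ hinj (fun a b hab => ?_)
    fun m n A B => Matrix.exists_units_map_mul_swapMatrix_eq hcont₁₂ hcont₂₁ hσopen hdense A B
  obtain ⟨r, hr⟩ := (hexact (a, b)).1 (sub_eq_zero.2 hab)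
  exact ⟨r, congrArg Prod.fst hr, congrArg Prod.snd hr⟩
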